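/- Let a and b be two distinct agents. For every call sequence σ in which the call ab does not occur and every formula φ of L^ck containing no occurrence of the negation symbol ¬: (M, σ) ⊨ C_{ab} φ if and only if (M, σ) ⊨ K_a K_b K_a K_b φ. (Under these conditions common knowledge of two agents coincides with 4-fold iterated knowledge.) -/

import Mathlib

namespace Gossip

/-- A call between two distinct agents. -/
structure Call (A : Type) where
  x : A
  y : A
  ne : x ≠ y

variable {A : Type} [DecidableEq A]

/-- Agent `a` is involved in the call `c`. -/
def Call.involves (c : Call A) (a : A) : Prop := a = c.x ∨ a = c.y

instance (c : Call A) (a : A) : Decidable (c.involves a) := by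
  unfold Call.involves; infer_instance

/-- `c` is the call between agents `a` and `b`. -/
def Call.isBetween (c : Call A) (a b : A) : Prop :=
  (c.x = a ∧ c.y = b) ∨ (c.x = b ∧ c.y = a)

instance (c : Call A) (a b : A) : Decidable (c.isBetween a b) := by
  unfold Call.isBetween; infer_instance

/-- The effect of a call on a gossip situation: the two agents involved
pool their secrets. -/
def Call.apply (c : Call A) (s : A → Finset A) : A → Finset A :=
  fun d => if d = c.x ∨ d = c.y then s c.x ∪ s c.y else s d

/-- The initial gossip situation: each agent is familiar only with their
own secret (secrets are identified with agents via the fixed bijection). -/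
def root : A → Finset A := fun a => {a}

/-- The result of applying a call sequence to a gossip situation. -/
def applySeq (σ : List (Call A)) (s : A → Finset A) : A → Finset A :=
  σ.foldl (fun t c => c.apply t) s

/-- `∼_a` : the smallest relation with `ε ∼_a ε`, closed under appending
calls not involving `a` on either side, and under appending a call
involving `a` on both sides when it yields the same set of secrets for `a`. -/
inductive AgEquiv (a : A) : List (Call A) → List (Call A) → Prop
  | nil : AgEquiv a [] []
  | extLeft {σ τ : List (Call A)} (c : Call A) :
      ¬ c.involves a → AgEquiv a σ τ → AgEquiv a (σ ++ [c]) τ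
  | extRight {σ τ : List (Call A)} (c : Call A) :
      ¬ c.involves a → AgEquiv a σ τ → AgEquiv a σ (τ ++ [c])
  | call {σ τ : List (Call A)} (c : Call A) :
      c.involves a →
      applySeq (σ ++ [c]) root a = applySeq (τ ++ [c]) root a →
      AgEquiv a σ τ → AgEquiv a (σ ++ [c]) (τ ++ [c])

/-- `∼_G` : reflexive-transitive closure of the union of the `∼_a`, `a ∈ G`. -/
def GEquiv (G : Finset A) : List (Call A) → List (Call A) → Prop :=
  Relation.ReflTransGen (fun σ τ => ∃ a ∈ G, AgEquiv a σ τ)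

/-- Formulas of the language `L^ck`. `fam a p` is `F_a p`,
`ck G φ` is `C_G φ`; `K_a φ` is `ck {a} φ`. -/
inductive Formula (A : Type) where
  | fam : A → A → Formula A
  | neg : Formula A → Formula A
  | conj : Formula A → Formula A → Formula A
  | ck : Finset A → Formula A → Formula A

/-- Truth of a formula at a call sequence (in the gossip model). -/
def Sat : Formula A → List (Call A) → Prop
  | .fam a p, σ => p ∈ applySeq σ root a
  | .neg φ, σ => ¬ Sat φ σ
  | .conj φ ψ, σ => Sat φ σ ∧ Sat ψ σ
  | .ck G φ, σ => ∀ τ, GEquiv G σ τ → Sat φ τ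

/-- `M ⊨ φ` : truth at every call sequence. -/
def Truth (φ : Formula A) : Prop := ∀ σ : List (Call A), Sat φ σ

/-- Formulas with no occurrence of the negation symbol. -/
def NegFree : Formula A → Prop
  | .fam _ _ => True
  | .neg _ => False
  | .conj φ ψ => NegFree φ ∧ NegFree ψ
  | .ck _ φ => NegFree φ

/-- Formulas with no occurrence of the `C_G` modalities (propositional part). -/
def CkFree : Formula A → Prop
  | .fam _ _ => True
  | .neg φ => CkFree φ
  | .conj φ ψ => CkFree φ ∧ CkFree ψ
  | .ck _ _ => False

/-- Formulas of `L_wn`: no nested occurrence of the `C_G` modalities. -/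
def NoNested : Formula A → Prop
  | .fam _ _ => True
  | .neg φ => NoNested φ
  | .conj φ ψ => NoNested φ ∧ NoNested ψ
  | .ck _ φ => CkFree φ

/-- The call `ab` occurs in `σ`. -/
def occursBetween (a b : A) (σ : List (Call A)) : Prop :=
  ∃ c ∈ σ, c.isBetween a b

/-- Epistemic pair-view component `Ṽ(σ)(a,b)`. -/
def pairView (σ : List (Call A)) (a b : A) : Set (A → Finset A) :=
  {s | ∃ τ, GEquiv {a, b} σ τ ∧ s = applySeq τ root}

/-- The full epistemic pair-view `Ṽ(σ)` : all components `Ṽ(σ)(a,b)`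
together with the designated situation `Ṽ(σ)(*) = σ(root)`. -/
def fullView (σ : List (Call A)) : (A → A → Set (A → Finset A)) × (A → Finset A) :=
  (pairView σ, applySeq σ root)

/-- A call sequence is pair-epistemically non-redundant if no nonempty
subsequence `σ₂` of a prefix `σ₁.σ₂` is pair-epistemically redundant. -/
def PairNonRedundant (σ : List (Call A)) : Prop :=
  ∀ σ₁ σ₂ : List (Call A), (σ₁ ++ σ₂) <+: σ → σ₂ ≠ [] →
    fullView σ₁ ≠ fullView (σ₁ ++ σ₂)

/-- Order on gossip situations: componentwise inclusion. -/
def gsLE (s t : A → Finset A) : Prop := ∀ a, s a ⊆ t a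

/-- The order `≤_EPV` on (the pair components of) epistemic pair-views. -/
def epvLE (V W : A → A → Set (A → Finset A)) : Prop :=
  ∀ a b : A, ∃ X : Set (A → Finset A), X ⊆ V a b ∧
    ∃ g : X → W a b, Function.Surjective g ∧ ∀ s : X, gsLE s.1 (g s).1

/-- `σ` is ab-redundant free: no call of `σ` different from the call `ab`
is redundant (leaves the current gossip situation unchanged). -/
def abRedundantFree (a b : A) (σ : List (Call A)) : Prop :=
  ∀ (i : ℕ) (h : i < σ.length), ¬ (σ.get ⟨i, h⟩).isBetween a b →
    (σ.get ⟨i, h⟩).apply (applySeq (σ.take i) root) ≠ applySeq (σ.take i) root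

lemma Call.apply_of_not_involves (c : Call A) (s : A → Finset A) {d : A}
    (h : ¬ c.involves d) : c.apply s d = s d :=
  if_neg h

lemma Call.subset_apply (c : Call A) (s : A → Finset A) (d : A) : s d ⊆ c.apply s d := by
  unfold Call.apply
  split_ifs with h
  · rcases h with rfl | rfl
    · exact Finset.subset_union_left
    · exact Finset.subset_union_right
  · exact subset_rfl

/-- The partner `e` of an agent `a` in a call `c` involving `a`. -/
lemma Call.exists_partner (c : Call A) {a : A} (h : c.involves a) :
    ∃ e, e ≠ a ∧ (∀ d, c.involves d ↔ d = a ∨ d = e) ∧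
      ∀ s : A → Finset A, ∀ d, c.apply s d = if d = a ∨ d = e then s a ∪ s e else s d := by
  rcases h with rfl | rfl
  · exact ⟨c.y, c.ne.symm, fun _ => Iff.rfl, fun _ _ => rfl⟩
  · refine ⟨c.x, c.ne, fun _ => or_comm, fun s d => ?_⟩
    simp only [Call.apply, or_comm, Finset.union_comm]

@[simp] lemma applySeq_nil (s : A → Finset A) : applySeq [] s = s := rfl

lemma applySeq_append (σ τ : List (Call A)) (s : A → Finset A) :
    applySeq (σ ++ τ) s = applySeq τ (applySeq σ s) :=
  List.foldl_append

lemma applySeq_concat (σ : List (Call A)) (c : Call A) (s : A → Finset A) :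
    applySeq (σ ++ [c]) s = c.apply (applySeq σ s) :=
  applySeq_append σ [c] s

lemma subset_applySeq (σ : List (Call A)) (s : A → Finset A) (d : A) :
    s d ⊆ applySeq σ s d := by
  induction σ using List.reverseRecOn with
  | nil => exact subset_rfl
  | append_singleton σ c ih =>
    rw [applySeq_concat]
    exact ih.trans (c.subset_apply _ d)

lemma mem_applySeq_root (σ : List (Call A)) (d : A) : d ∈ applySeq σ root d :=
  subset_applySeq σ root d (Finset.mem_singleton_self d)

lemma applySeq_of_not_involves {σ : List (Call A)} {d : A} (h : ∀ c ∈ σ, ¬ c.involves d)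
    (s : A → Finset A) : applySeq σ s d = s d := by
  induction σ using List.reverseRecOn with
  | nil => rfl
  | append_singleton σ c ih =>
    rw [applySeq_concat, c.apply_of_not_involves _ (h c (by simp)),
      ih fun c' hc' => h c' (by simp [hc'])]

lemma AgEquiv.refl (a : A) (σ : List (Call A)) : AgEquiv a σ σ := by
  induction σ using List.reverseRecOn with
  | nil => exact .nil
  | append_singleton σ c ih =>
    by_cases hc : c.involves a
    · exact .call c hc rfl ih
    · exact .extLeft c hc (.extRight c hc ih)

lemma AgEquiv.append_right {a : A} {σ τ ρ : List (Call A)} (h : AgEquiv a σ τ)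
    (hρ : ∀ c ∈ ρ, ¬ c.involves a) : AgEquiv a σ (τ ++ ρ) := by
  induction ρ using List.reverseRecOn with
  | nil => simpa using h
  | append_singleton ρ c ih =>
    rw [← List.append_assoc]
    exact .extRight c (hρ c (by simp)) (ih fun c' hc' => hρ c' (by simp [hc']))

lemma AgEquiv.append_left {a : A} {σ τ ρ : List (Call A)} (h : AgEquiv a σ τ)
    (hρ : ∀ c ∈ ρ, ¬ c.involves a) : AgEquiv a (σ ++ ρ) τ := by
  induction ρ using List.reverseRecOn with
  | nil => simpa using h
  | append_singleton ρ c ih =>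
    rw [← List.append_assoc]
    exact .extLeft c (hρ c (by simp)) (ih fun c' hc' => hρ c' (by simp [hc']))

lemma AgEquiv.gEquiv {a : A} {G : Finset A} {σ τ : List (Call A)} (ha : a ∈ G)
    (h : AgEquiv a σ τ) : GEquiv G σ τ :=
  .single ⟨a, ha, h⟩

lemma GEquiv.mono {G H : Finset A} (hGH : G ⊆ H) {σ τ : List (Call A)} (h : GEquiv G σ τ) :
    GEquiv H σ τ :=
  Relation.ReflTransGen.mono (fun _ _ ⟨a, ha, hστ⟩ => ⟨a, hGH ha, hστ⟩) _ _ h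

/-- A negation-free formula that holds initially holds after every call sequence. -/
lemma NegFree.sat_of_sat_nil {φ : Formula A} (hφ : NegFree φ) (h : Sat φ [])
    (σ : List (Call A)) : Sat φ σ := by
  induction φ generalizing σ with
  | fam d p =>
    exact subset_applySeq σ root d h
  | neg φ _ => exact hφ.elim
  | conj φ ψ ih₁ ih₂ => exact ⟨ih₁ hφ.1 h.1 σ, ih₂ hφ.2 h.2 σ⟩
  | ck G φ ih => exact fun τ _ => ih hφ (h [] .refl) τ

/-- Deleting all calls of `b` does not change what is known by the agents who are
not familiar with the secret of `b`. -/
lemma applySeq_filter_of_notMem (b : A) (σ : List (Call A)) {d : A}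
    (hd : b ∉ applySeq σ root d) :
    applySeq (σ.filter fun c => ¬ c.involves b) root d = applySeq σ root d := by
  induction σ using List.reverseRecOn generalizing d with
  | nil => rfl
  | append_singleton σ c ih =>
    rw [applySeq_concat] at hd ⊢
    rw [List.filter_append]
    by_cases hcd : c.involves d
    · obtain ⟨e, -, hinv, happ⟩ := c.exists_partner hcd
      rw [happ] at hd ⊢
      simp only [true_or, if_true, Finset.mem_union, not_or] at hd ⊢
      have hb : ¬ c.involves b := by
        rw [hinv]
        rintro (rfl | rfl)
        · exact hd.1 (mem_applySeq_root σ b)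
        · exact hd.2 (mem_applySeq_root σ b)
      rw [List.filter_cons_of_pos (by simpa using hb), List.filter_nil, applySeq_concat, happ]
      rw [if_pos (.inl rfl), ih hd.1, ih hd.2]
    · rw [c.apply_of_not_involves _ hcd] at hd ⊢
      rw [applySeq_append, applySeq_of_not_involves, ih hd]
      intro c' hc'
      have : c' = c := by simpa using List.mem_of_mem_filter hc'
      exact this ▸ hcd

/-- An agent not familiar with the secret of `b` considers it possible that
`b` did not make any call. -/
lemma agEquiv_filter_of_notMem {a b : A} {σ : List (Call A)} (h : b ∉ applySeq σ root a) :
    AgEquiv a σ (σ.filter fun c => ¬ c.involves b) := by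
  induction σ using List.reverseRecOn with
  | nil => exact .nil
  | append_singleton σ c ih =>
    have h₀ : b ∉ applySeq σ root a := by
      rw [applySeq_concat] at h
      exact fun hb => h (c.subset_apply _ a hb)
    have hfilter := applySeq_filter_of_notMem b (σ ++ [c]) h
    rw [List.filter_append] at hfilter ⊢
    by_cases hca : c.involves a
    · have hcb : ¬ c.involves b := by
        intro hcb
        obtain ⟨e, -, hinv, happ⟩ := c.exists_partner hcb
        rw [applySeq_concat, happ, if_pos ((hinv a).1 hca)] at h
        exact h (Finset.mem_union_left _ (mem_applySeq_root σ b))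
      rw [List.filter_cons_of_pos (by simpa using hcb), List.filter_nil] at hfilter ⊢
      exact .call c hca hfilter.symm (ih h₀)
    · refine .extLeft c hca ((ih h₀).append_right fun c' hc' => ?_)
      exact List.mem_singleton.1 (List.mem_of_mem_filter hc') ▸ hca

/-- An agent `e` can collect the secrets of all agents in `N` by calling each of them,
without any agent involved getting to know a secret outside `T`. -/
lemma exists_gathering (e : A) (T N : Finset A) (s : A → Finset A) (he : e ∉ N)
    (hself : ∀ d ∈ N, d ∈ s d) (hT : ∀ d, d = e ∨ d ∈ N → s d ⊆ T) :
    ∃ ρ : List (Call A), (∀ c ∈ ρ, ∀ d, c.involves d → d = e ∨ d ∈ N) ∧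
      N ⊆ applySeq ρ s e ∧ ∀ d, d = e ∨ d ∈ N → applySeq ρ s d ⊆ T := by
  induction N using Finset.induction_on with
  | empty => exact ⟨[], by simp, by simp, by simpa using hT⟩
  | insert x N hx ih =>
    obtain ⟨hex, heN⟩ : e ≠ x ∧ e ∉ N := by simpa using he
    obtain ⟨ρ, hρ, hN, hρT⟩ := ih heN (fun d hd => hself d (Finset.mem_insert_of_mem hd))
      fun d hd => hT d (hd.imp_right Finset.mem_insert_of_mem)
    have hxT : applySeq ρ s x ⊆ T := by
      rw [applySeq_of_not_involves fun c hc hcx => ?_]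
      · exact hT x (by simp)
      · exact (hρ c hc x hcx).elim (fun h => hex h.symm) hx
    have heT := hρT e (.inl rfl)
    refine ⟨ρ ++ [⟨e, x, hex⟩], ?_, ?_, ?_⟩
    · intro c hc d hd
      rcases List.mem_append.1 hc with hc | hc
      · exact (hρ c hc d hd).imp_right Finset.mem_insert_of_mem
      · rw [List.mem_singleton.1 hc] at hd
        exact hd.imp_right fun h => by simp [show d = x from h]
    · rw [applySeq_concat]
      simp only [Call.apply, true_or, if_true]
      refine Finset.insert_subset (Finset.mem_union_right _ ?_)
        (hN.trans Finset.subset_union_left)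
      exact subset_applySeq ρ s x (hself x (by simp))
    · intro d hd
      rw [applySeq_concat]
      simp only [Call.apply]
      split_ifs with h
      · exact Finset.union_subset heT hxT
      · push Not at h
        refine hρT d (hd.imp_right fun hd => ?_)
        exact (Finset.mem_insert.1 hd).resolve_left h.2

/-- If `a` and `b` do not call each other in `σ`, then `a` considers possible a call
sequence `τ` after which `b` considers possible that `a` is not familiar with the secret
of `b`. In `τ`, the calls not involving `a` take place as late as possible and only
involve agents whose secret `a` is familiar with in the end. -/
lemma exists_agEquiv_agEquiv_notMem {a b : A} (hab : a ≠ b) {σ : List (Call A)}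
    (h : ¬ occursBetween a b σ) :
    ∃ τ υ, AgEquiv a σ τ ∧ AgEquiv b τ υ ∧ b ∉ applySeq υ root a ∧
      applySeq τ root a = applySeq σ root a ∧
      (∀ d ∈ applySeq σ root a, applySeq τ root d ⊆ applySeq σ root a) ∧
      ∀ d ∉ applySeq σ root a, applySeq τ root d = {d} := by
  induction σ using List.reverseRecOn with
  | nil =>
    refine ⟨[], [], .nil, .nil, ?_, rfl, ?_, fun _ _ => rfl⟩
    · simpa [root] using hab.symm
    · simp [root]
  | append_singleton σ c ih =>
    obtain ⟨τ, υ, hστ, hτυ, hbυ, hτa, hτS, hτd⟩ :=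
      ih fun ⟨c', hc', hb⟩ => h ⟨c', by simp [hc'], hb⟩
    rw [applySeq_concat]
    by_cases hca : c.involves a
    swap
    · rw [c.apply_of_not_involves _ hca]
      exact ⟨τ, υ, .extLeft c hca hστ, hτυ, hbυ, hτa, hτS, hτd⟩
    obtain ⟨e, hea, hinv, happ⟩ := c.exists_partner hca
    have hcb : ¬ c.involves b := by
      intro hcb
      refine h ⟨c, by simp, ?_⟩
      rcases hca with hx | hy
      · exact .inl ⟨hx.symm, (hcb.resolve_left fun h => hab (hx.trans h.symm)).symm⟩
      · exact .inr ⟨(hcb.resolve_right fun h => hab (hy.trans h.symm)).symm, hy.symm⟩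
    have hbe : b ≠ e := fun hbe => hcb ((hinv b).2 (.inr hbe))
    set S := applySeq σ root a with hS
    have haS : a ∈ S := mem_applySeq_root σ a
    set T := c.apply (applySeq σ root) a with hT
    have hST : S ⊆ T := c.subset_apply _ a
    have heT : e ∈ T := by
      rw [hT, happ, if_pos (.inl rfl)]
      exact Finset.mem_union_right _ (mem_applySeq_root σ e)
    set N := (T \ S).erase e with hNdef
    have hN : ∀ {d}, d ∈ N ↔ d ≠ e ∧ d ∈ T ∧ d ∉ S := by simp [N]
    have hself : ∀ d, applySeq τ root d ⊆ insert d T := by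
      intro d
      by_cases hd : d ∈ S
      · exact (hτS d hd).trans (hST.trans (Finset.subset_insert _ _))
      · rw [hτd d hd]
        simp
    have hτT : ∀ d ∈ T, applySeq τ root d ⊆ T := fun d hd => by
      simpa [Finset.insert_eq_of_mem hd] using hself d
    obtain ⟨ρ, hρ, hNρ, hρT⟩ := exists_gathering e T N (applySeq τ root) (by simp [N])
      (fun d _ => mem_applySeq_root τ d)
      (by rintro d (rfl | hd); exacts [hτT _ heT, hτT d (hN.1 hd).2.1])
    have hρS : ∀ d ∈ S, d ≠ e → ∀ c ∈ ρ, ¬ c.involves d := fun d hd hde c hc hcd =>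
      (hρ c hc d hcd).elim hde fun h => (hN.1 h).2.2 hd
    have hρa : applySeq (τ ++ ρ) root a = S := by
      rw [applySeq_append, applySeq_of_not_involves (hρS a haS hea.symm), hτa]
    have hρe : applySeq (τ ++ ρ) root e ⊆ T := by
      rw [applySeq_append]; exact hρT e (.inl rfl)
    have hunion : S ∪ applySeq (τ ++ ρ) root e = T := by
      refine (Finset.union_subset hST hρe).antisymm fun d hd => ?_
      by_cases hdS : d ∈ S
      · exact Finset.mem_union_left _ hdS
      refine Finset.mem_union_right _ ?_
      by_cases hde : d = e
      · exact hde ▸ mem_applySeq_root _ d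
      · rw [applySeq_append]
        exact hNρ (hN.2 ⟨hde, hd, hdS⟩)
    have hnew : ∀ d, applySeq (τ ++ ρ ++ [c]) root d =
        if d = a ∨ d = e then T else applySeq ρ (applySeq τ root) d := by
      intro d
      rw [applySeq_concat, happ, hρa, hunion, applySeq_append]
    have hstep : AgEquiv a (σ ++ [c]) (τ ++ ρ ++ [c]) :=
      .call c hca (by rw [hnew, if_pos (.inl rfl), applySeq_concat])
        (hστ.append_right (hρS a haS hea.symm))
    have hnewT : ∀ d ∈ T, applySeq (τ ++ ρ ++ [c]) root d ⊆ T := by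
      intro d hd
      rw [hnew]
      split_ifs with hd'
      · exact subset_rfl
      push Not at hd'
      by_cases hdS : d ∈ S
      · rw [applySeq_of_not_involves (hρS d hdS hd'.2)]
        exact hτT d hd
      · exact hρT d (.inr (hN.2 ⟨hd'.2, hd, hdS⟩))
    have hnewd : ∀ d ∉ T, applySeq (τ ++ ρ ++ [c]) root d = {d} := by
      intro d hd
      rw [hnew, if_neg, applySeq_of_not_involves, hτd d fun h => hd (hST h)]
      · exact fun c' hc' hcd => (hρ c' hc' d hcd).elim (fun h => hd (h ▸ heT))
          fun h => hd (hN.1 h).2.1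
      · rintro (rfl | rfl)
        · exact hd (hST haS)
        · exact hd heT
    have hnewa : applySeq (τ ++ ρ ++ [c]) root a = T := by rw [hnew, if_pos (.inl rfl)]
    by_cases hbS : b ∈ S
    · refine ⟨_, υ, hstep, ?_, hbυ, hnewa, hnewT, hnewd⟩
      exact .extLeft c hcb (hτυ.append_left (hρS b hbS hbe))
    · exact ⟨_, τ ++ ρ, hstep, .extLeft c hcb (.refl b _), hρa ▸ hbS, hnewa, hnewT, hnewd⟩

theorem stmt8 {A : Type} [DecidableEq A] [Fintype A] (hA : 3 ≤ Fintype.card A)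
    (a b : A) (hab : a ≠ b) (σ : List (Call A)) (h : ¬ occursBetween a b σ)
    (φ : Formula A) (hφ : NegFree φ) :
    Sat (Formula.ck {a, b} φ) σ ↔
      Sat (Formula.ck {a} (Formula.ck {b} (Formula.ck {a} (Formula.ck {b} φ)))) σ := by
  constructor
  · intro H τ₁ h₁ τ₂ h₂ τ₃ h₃ τ₄ h₄
    have ha : ({a} : Finset A) ⊆ {a, b} := by simp
    have hb : ({b} : Finset A) ⊆ {a, b} := by simp
    exact H τ₄ ((((h₁.mono ha).trans (h₂.mono hb)).trans (h₃.mono ha)).trans (h₄.mono hb))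
  · intro H τ _
    obtain ⟨τ₁, τ₂, h₁, h₂, hb, -⟩ := exists_agEquiv_agEquiv_notMem hab h
    have h₃ := agEquiv_filter_of_notMem hb
    have h₄ : AgEquiv b (τ₂.filter fun c => ¬ c.involves b) [] :=
      AgEquiv.append_left (σ := []) .nil fun c hc => by simpa using List.of_mem_filter hc
    exact hφ.sat_of_sat_nil (H _ (h₁.gEquiv (by simp)) _ (h₂.gEquiv (by simp)) _
      (h₃.gEquiv (by simp)) _ (h₄.gEquiv (by simp))) τ

end Gossip
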